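/- Let M be a pointwise finite-dimensional persistence module over ℤ² with a rectangle decomposition M ≅ ⊕_{R ∈ 𝓡} k_R for a multiset 𝓡 of rectangles of ℤ². For s = (s_x, s_y) ≤ t = (t_x, t_y) in ℤ², let m(s, t) denote the multiplicity in 𝓡 of the rectangle [s_x, t_x] × [s_y, t_y]. Then m(s, t) = Σ_{i,j,k,l ∈ {0,1}} (−1)^{i+j+k+l} · r((s_x−i, s_y−j), (t_x+k, t_y+l)), where r(u, v) denotes the rank of ρ_u^v. -/

import Mathlib

open CategoryTheory Limits Set

noncomputable section

set_option linter.unusedSectionVars false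

attribute [local instance] Classical.propDecidable

namespace PersistencePaper

/-- A persistence module over a poset `P`, with coefficients in a field `k`:
a functor from `P` (viewed as a category) to the category of `k`-vector spaces. -/
abbrev PersistenceModule (k : Type) [Field k] (P : Type) [Preorder P] : Type 1 :=
  P ⥤ ModuleCat k

variable (k : Type) [Field k]

section Indicator

variable {P : Type} [Preorder P]

/-- The fiber of the indicator module of a set `Q ⊆ P` at a point `t : P`,
realized as a submodule of `k`: it is all of `k` when `t ∈ Q` and `0` otherwise. -/
def indSub (Q : Set P) (t : P) : Submodule k k where
  carrier := {x | t ∉ Q → x = 0}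
  add_mem' := by intro a b ha hb ht; rw [ha ht, hb ht, add_zero]
  zero_mem' := fun _ => rfl
  smul_mem' := by intro c x hx ht; rw [hx ht, smul_zero]

/-- The structure map of the indicator module: the identity when both endpoints lie in
`Q`, and zero otherwise. -/
def indMap (Q : Set P) (s t : P) : indSub k Q s →ₗ[k] indSub k Q t where
  toFun x := ⟨if s ∈ Q ∧ t ∈ Q then (x : k) else 0, by
    intro ht
    split_ifs with h
    · exact absurd h.2 ht
    · rfl⟩
  map_add' x y := by apply Subtype.ext; split_ifs <;> simp
  map_smul' c x := by apply Subtype.ext; split_ifs <;> simp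

theorem indMap_coe (Q : Set P) (s t : P) (x : indSub k Q s) :
    (indMap k Q s t x : k) = if s ∈ Q ∧ t ∈ Q then (x : k) else 0 := rfl

/-- The indicator persistence module `k_Q` of a convex subset `Q` of a poset `P`:
it assigns `k` to points of `Q` and `0` elsewhere, the structure maps being the identity
between points of `Q` and zero otherwise. -/
def indicator (Q : Set P) (hQ : Q.OrdConnected) : PersistenceModule k P where
  obj t := ModuleCat.of k (indSub k Q t)
  map {s t} _ := ModuleCat.ofHom (indMap k Q s t)
  map_id t := by
    refine ModuleCat.hom_ext <| LinearMap.ext fun x => Subtype.ext ?_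
    show (indMap k Q t t x).val = Subtype.val x
    rw [indMap_coe]
    split_ifs with h
    · rfl
    · exact (x.2 fun ht => h ⟨ht, ht⟩).symm
  map_comp {s t u} f g := by
    refine ModuleCat.hom_ext <| LinearMap.ext fun x => Subtype.ext ?_
    show (indMap k Q s u x).val = (indMap k Q t u (indMap k Q s t x)).val
    rw [indMap_coe, indMap_coe, indMap_coe]
    by_cases hs : s ∈ Q <;> by_cases hu : u ∈ Q
    · have ht : t ∈ Q := hQ.out hs hu ⟨leOfHom f, leOfHom g⟩
      simp [hs, ht, hu]
    · simp [hs, hu]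
    · simp [hs, hu]
    · simp [hs, hu]

/-- The structure map `ρ_s^t : M_s → M_t` of a persistence module, as a linear map. -/
def rho (M : PersistenceModule k P) {s t : P} (h : s ≤ t) : M.obj s →ₗ[k] M.obj t :=
  (M.map (homOfLE h)).hom

/-- The rank invariant `r(s,t)` of a persistence module: the rank of `ρ_s^t` when `s ≤ t`,
and `0` (by convention) otherwise. -/
def rk (M : PersistenceModule k P) (s t : P) : ℕ :=
  if h : s ≤ t then Module.finrank k (LinearMap.range (rho k M h)) else 0

/-- A persistence module is pointwise finite-dimensional (pfd) if all its spaces are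
finite-dimensional. -/
def Pfd (M : PersistenceModule k P) : Prop :=
  ∀ t : P, FiniteDimensional k (M.obj t)

/-- An interval of a poset: a nonempty, convex and zigzag-connected subset. -/
def IsInterval (Q : Set P) : Prop :=
  Q.Nonempty ∧ Q.OrdConnected ∧
    ∀ p ∈ Q, ∀ q ∈ Q,
      Relation.ReflTransGen (fun a b => a ∈ Q ∧ b ∈ Q ∧ (a ≤ b ∨ b ≤ a)) p q

/-- A persistence module is interval-decomposable if it is isomorphic to a direct sum
of indicator modules of intervals. -/
def IntervalDecomposable (M : PersistenceModule k P) : Prop :=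
  ∃ (ι : Type) (I : ι → Set P) (hI : ∀ i, IsInterval (I i)),
    Nonempty (M ≅ ∐ fun i => indicator k (I i) (hI i).2.1)

end Indicator

section Rect

variable {X Y : Type} [Preorder X] [Preorder Y]

/-- A rectangle in the product poset `X × Y`: a nonempty product `I ×ˢ J` of an
interval (convex subset) of `X` with an interval of `Y`. -/
def IsRectangle (R : Set (X × Y)) : Prop :=
  R.Nonempty ∧ ∃ (I : Set X) (J : Set Y), I.OrdConnected ∧ J.OrdConnected ∧ R = I ×ˢ J

theorem IsRectangle.ordConnected {R : Set (X × Y)} (h : IsRectangle R) :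
    R.OrdConnected := by
  obtain ⟨-, I, J, hI, hJ, rfl⟩ := h
  constructor
  intro x hx y hy z hz
  exact ⟨hI.out hx.1 hy.1 ⟨hz.1.1, hz.2.1⟩, hJ.out hx.2 hy.2 ⟨hz.1.2, hz.2.2⟩⟩

/-- A persistence bimodule is rectangle-decomposable if it is isomorphic to a direct sum
of indicator (rectangle) modules of rectangles. -/
def RectangleDecomposable (M : PersistenceModule k (X × Y)) : Prop :=
  ∃ (ι : Type) (R : ι → Set (X × Y)) (hR : ∀ i, IsRectangle (R i)),
    Nonempty (M ≅ ∐ fun i => indicator k (R i) (hR i).ordConnected)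

/-- A persistence bimodule `M` over `X × Y` is weakly exact if for all `s ≤ t`,
`Im ρ_s^t = Im ρ_{(t₁,s₂)}^t ∩ Im ρ_{(s₁,t₂)}^t` and
`Ker ρ_s^t = Ker ρ_s^{(t₁,s₂)} + Ker ρ_s^{(s₁,t₂)}`. -/
def WeaklyExact (M : PersistenceModule k (X × Y)) : Prop :=
  ∀ (s t : X × Y) (h : s ≤ t),
    (LinearMap.range (rho k M h) =
        LinearMap.range (rho k M (show (t.1, s.2) ≤ t from ⟨le_refl t.1, h.2⟩)) ⊓
        LinearMap.range (rho k M (show (s.1, t.2) ≤ t from ⟨h.1, le_refl t.2⟩))) ∧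
    (LinearMap.ker (rho k M h) =
        LinearMap.ker (rho k M (show s ≤ (t.1, s.2) from ⟨h.1, le_refl s.2⟩)) ⊔
        LinearMap.ker (rho k M (show s ≤ (s.1, t.2) from ⟨le_refl s.1, h.2⟩)))

/-- The space (fiber) of a persistence module at an index. -/
abbrev fiber {k : Type} [Field k] {P : Type} [Preorder P]
    (M : PersistenceModule k P) (t : P) : ModuleCat k :=
  M.obj t

/-- Morphisms of persistence modules (natural transformations). -/
abbrev PMHom {k : Type} [Field k] {P : Type} [Preorder P]
    (M N : PersistenceModule k P) : Type :=
  M ⟶ N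

/-- The component of a morphism of persistence modules at an index, as a linear map. -/
abbrev PMHom.appLin {k : Type} [Field k] {P : Type} [Preorder P]
    {M N : PersistenceModule k P} (f : PMHom M N) (t : P) :
    M.obj t →ₗ[k] N.obj t :=
  (f.app t).hom

/-- The restriction of a persistence module to a subset of its indexing poset. -/
def restrict {P : Type} [Preorder P] (M : PersistenceModule k P) (S : Set P) :
    PersistenceModule k ↥S :=
  (show Monotone (Subtype.val : ↥S → P) from fun _ _ h => h).functor ⋙ M

/-- The pullback (restriction) of a persistence module along a monotone map of posets. -/
def restrictAlong {P R : Type} [Preorder P] [Preorder R] {f : R → P} (hf : Monotone f)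
    (M : PersistenceModule k P) : PersistenceModule k R :=
  hf.functor ⋙ M

/-- The right Kan extension of a persistence module along a monotone map of posets. -/
def ranAlong {P R : Type} [Preorder P] [Preorder R] {f : P → R} (hf : Monotone f)
    (M : PersistenceModule k P) : PersistenceModule k R :=
  hf.functor.ran.obj M

/-- `M` decomposes as a direct sum of indicator modules whose supports are drawn from
the family `A` of (convex) subsets of the indexing poset. -/
def DecomposesWithSupports {P : Type} [Preorder P] (M : PersistenceModule k P)
    (A : Set (Set P)) : Prop :=
  ∃ (ι : Type) (Q : ι → Set P) (_ : ∀ i, Q i ∈ A) (hconv : ∀ i, (Q i).OrdConnected),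
    Nonempty (M ≅ ∐ fun i => indicator k (Q i) (hconv i))

end Rect

end PersistencePaper
namespace PersistencePaper

section Helpers

variable {P : Type} [Preorder P]

/-- Explicit direct sum of indicator modules. -/
def dsum (k : Type) [Field k] {ι : Type} (R : ι → Set P) (hR : ∀ i, (R i).OrdConnected) :
    PersistenceModule k P where
  obj t := ModuleCat.of k (Π₀ i, indSub k (R i) t)
  map {s t} _ := ModuleCat.ofHom (DFinsupp.mapRange.linearMap fun i => indMap k (R i) s t)
  map_id t := by
    refine ModuleCat.hom_ext ?_
    have : ∀ i, indMap k (R i) t t = LinearMap.id := fun i =>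
      congrArg ModuleCat.Hom.hom ((indicator k (R i) (hR i)).map_id t)
    simp [this]
  map_comp {s t u} f g := by
    refine ModuleCat.hom_ext ?_
    have : ∀ i, indMap k (R i) s u = (indMap k (R i) t u).comp (indMap k (R i) s t) := fun i =>
      congrArg ModuleCat.Hom.hom ((indicator k (R i) (hR i)).map_comp f g)
    simp only [this, DFinsupp.mapRange.linearMap_comp]
    rfl

/-- Inclusion of a summand. -/
def dincl (k : Type) [Field k] {ι : Type} (R : ι → Set P) (hR : ∀ i, (R i).OrdConnected) (i : ι) :
    indicator k (R i) (hR i) ⟶ dsum k R hR where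
  app t := ModuleCat.ofHom (DFinsupp.lsingle (M := fun i => indSub k (R i) t) i)
  naturality s t f := by
    refine ModuleCat.hom_ext <| LinearMap.ext fun x => ?_
    exact (DFinsupp.mapRange_single (f := fun i => indMap k (R i) s t)
      (hf := fun i => map_zero _) (i := i) (b := x)).symm

/-- The canonical map out of the explicit direct sum. -/
def ddesc (k : Type) [Field k] {ι : Type} (R : ι → Set P) (hR : ∀ i, (R i).OrdConnected)
    (N : PersistenceModule k P) (φ : ∀ i, indicator k (R i) (hR i) ⟶ N) :
    dsum k R hR ⟶ N where
  app t := ModuleCat.ofHom (DFinsupp.lsum (M := fun i => indSub k (R i) t) ℕ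
    (fun i => ((φ i).app t).hom))
  naturality s t f := by
    refine ModuleCat.hom_ext ?_
    refine DFinsupp.lhom_ext (M := fun i => indSub k (R i) s) fun i x => ?_
    have h1 := LinearMap.congr_fun (congrArg ModuleCat.Hom.hom ((φ i).naturality f)) x
    have h2 := DFinsupp.mapRange_single (f := fun i => indMap k (R i) s t)
      (hf := fun i => map_zero _) (i := i) (b := x)
    show DFinsupp.lsum (M := fun i => indSub k (R i) t) ℕ
        (fun i => ((φ i).app t).hom) (DFinsupp.mapRange (fun i => indMap k (R i) s t)
          (fun i => map_zero _) (DFinsupp.single i x)) =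
      (N.map f).hom (DFinsupp.lsum (M := fun i => indSub k (R i) s) ℕ
        (fun i => ((φ i).app s).hom) (DFinsupp.single i x))
    have h3 := DFinsupp.lsum_single (M := fun i => indSub k (R i) t) ℕ
      (fun i => ((φ i).app t).hom) i (indMap k (R i) s t x)
    have h4 := DFinsupp.lsum_single (M := fun i => indSub k (R i) s) ℕ
      (fun i => ((φ i).app s).hom) i x
    exact ((congrArg _ h2).trans h3).trans (h1.trans (congrArg (N.map f).hom h4.symm))

theorem dincl_ddesc (k : Type) [Field k] {ι : Type} (R : ι → Set P)
    (hR : ∀ i, (R i).OrdConnected)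
    (N : PersistenceModule k P) (φ : ∀ i, indicator k (R i) (hR i) ⟶ N) (i : ι) :
    dincl k R hR i ≫ ddesc k R hR N φ = φ i := by
  ext t : 2
  refine ModuleCat.hom_ext <| LinearMap.ext fun x => ?_
  exact DFinsupp.lsum_single (M := fun i => indSub k (R i) t) ℕ
    (fun i => ((φ i).app t).hom) i x

theorem dsum_hom_ext (k : Type) [Field k] {ι : Type} (R : ι → Set P)
    (hR : ∀ i, (R i).OrdConnected)
    (N : PersistenceModule k P) (f g : dsum k R hR ⟶ N)
    (h : ∀ i, dincl k R hR i ≫ f = dincl k R hR i ≫ g) : f = g := by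
  ext t : 2
  refine ModuleCat.hom_ext ?_
  refine DFinsupp.lhom_ext (M := fun i => indSub k (R i) t) fun i x => ?_
  exact LinearMap.congr_fun (congrArg ModuleCat.Hom.hom (congrArg (fun α => α.app t) (h i))) x

/-- The coproduct is the explicit direct sum. -/
def coprodIso (k : Type) [Field k] {ι : Type} (R : ι → Set P) (hR : ∀ i, (R i).OrdConnected) :
    (∐ fun i => indicator k (R i) (hR i)) ≅ dsum k R hR where
  hom := Sigma.desc (dincl k R hR)
  inv := ddesc k R hR _ (fun i => Sigma.ι (fun i => indicator k (R i) (hR i)) i)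
  hom_inv_id := by
    refine Sigma.hom_ext _ _ fun i => ?_
    rw [Sigma.ι_desc_assoc, dincl_ddesc, Category.comp_id]
  inv_hom_id := by
    refine dsum_hom_ext k R hR _ _ _ fun i => ?_
    rw [← Category.assoc, dincl_ddesc, Sigma.ι_desc, Category.comp_id]

theorem rk_iso (k : Type) [Field k] {M N : PersistenceModule k P} (e : M ≅ N) (u v : P) :
    rk k M u v = rk k N u v := by
  unfold rk
  split_ifs with h
  · let eu := (e.app u).toLinearEquiv
    let ev := (e.app v).toLinearEquiv
    have hc : (ev : M.obj v →ₗ[k] N.obj v) ∘ₗ rho k M h = rho k N h ∘ₗ (eu : M.obj u →ₗ[k] N.obj u) :=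
      congrArg ModuleCat.Hom.hom (e.hom.naturality (homOfLE h))
    have h1 : LinearMap.range (rho k N h) = (LinearMap.range (rho k M h)).map
        (ev : M.obj v →ₗ[k] N.obj v) := by
      rw [← LinearMap.range_comp, hc, LinearMap.range_comp_of_range_eq_top _ (LinearEquiv.range eu)]
    rw [h1]
    exact (LinearEquiv.finrank_map_eq ev _).symm
  · rfl

/-- Basis vectors of the image. -/
def bvec (k : Type) [Field k] {ι : Type} (R : ι → Set P) (v : P)
    (i : {i | v ∈ R i}) : Π₀ i, indSub k (R i) v :=
  DFinsupp.single i.1 ⟨1, fun h => absurd i.2 h⟩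

theorem bvec_li (k : Type) [Field k] {ι : Type} (R : ι → Set P) (v : P) :
    LinearIndependent k (bvec k R v) := by
  rw [linearIndependent_iff']
  intro s g hg i hi
  have := congrArg (fun f => ((f i.1 : indSub k (R i.1) v) : k)) hg
  simp only [DFinsupp.finsetSum_apply, DFinsupp.smul_apply, bvec, DFinsupp.zero_apply,
    AddSubmonoidClass.coe_finsetSum, Submodule.coe_smul, Submodule.coe_zero] at this
  rw [Finset.sum_eq_single i] at this
  · simpa using this
  · intro j _ hj
    rw [DFinsupp.single_eq_of_ne (fun h => hj (Subtype.ext h.symm))]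
    simp
  · exact fun h => absurd hi h

theorem finite_dsum (k : Type) [Field k] {ι : Type} (R : ι → Set P)
    (v : P) (hf : FiniteDimensional k (Π₀ i, indSub k (R i) v)) : {i | v ∈ R i}.Finite := by
  have : Finite {i | v ∈ R i} := (bvec_li k R v).finite
  exact Set.toFinite _

theorem finite_of_iso (k : Type) [Field k] {ι : Type} (R : ι → Set P)
    (hR : ∀ i, (R i).OrdConnected) (M : PersistenceModule k P) (hM : Pfd k M)
    (e : M ≅ dsum k R hR) (v : P) : {i | v ∈ R i}.Finite := by
  have : FiniteDimensional k (M.obj v) := hM v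
  exact finite_dsum k R v (LinearEquiv.finiteDimensional (e.app v).toLinearEquiv)

theorem rk_dsum (k : Type) [Field k] {ι : Type} (R : ι → Set P) (hR : ∀ i, (R i).OrdConnected)
    (u v : P) (huv : u ≤ v) (hf : {i | v ∈ R i}.Finite) :
    rk k (dsum k R hR) u v = {i | u ∈ R i ∧ v ∈ R i}.ncard := by
  unfold rk
  rw [dif_pos huv]
  let b : {i | u ∈ R i ∧ v ∈ R i} → Π₀ i, indSub k (R i) v := fun i => bvec k R v ⟨i.1, i.2.2⟩
  have hb : LinearIndependent k b := (bvec_li k R v).comp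
    (fun i : {i | u ∈ R i ∧ v ∈ R i} => (⟨i.1, i.2.2⟩ : {i | v ∈ R i}))
    (fun i j h => Subtype.ext (congrArg (fun x => x.1) h))
  have hfin : {i | u ∈ R i ∧ v ∈ R i}.Finite := hf.subset fun i hi => hi.2
  have : Fintype {i | u ∈ R i ∧ v ∈ R i} := hfin.fintype
  have hr : LinearMap.range (DFinsupp.mapRange.linearMap fun i => indMap k (R i) u v) =
      Submodule.span k (Set.range b) := by
    apply le_antisymm
    · rw [LinearMap.range_eq_map, ← DFinsupp.iSup_range_lsingle, Submodule.map_iSup]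
      refine iSup_le fun i => ?_
      rw [← LinearMap.range_comp]
      rintro _ ⟨x, rfl⟩
      simp only [LinearMap.comp_apply, DFinsupp.lsingle_apply,
        DFinsupp.mapRange.linearMap_apply, DFinsupp.mapRange_single]
      by_cases h : u ∈ R i ∧ v ∈ R i
      · have : (DFinsupp.single i (indMap k (R i) u v x) : Π₀ i, indSub k (R i) v) =
            (x : k) • b ⟨i, h⟩ := by
          simp only [b, bvec, ← DFinsupp.single_smul]
          congr 1
          apply Subtype.ext
          rw [indMap_coe, if_pos h]
          simp
        rw [this]
        exact Submodule.smul_mem _ _ (Submodule.subset_span ⟨_, rfl⟩)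
      · have : indMap k (R i) u v x = 0 := by
          apply Subtype.ext
          rw [indMap_coe, if_neg h]
          rfl
        rw [this, DFinsupp.single_zero]
        exact Submodule.zero_mem _
    · rw [Submodule.span_le]
      rintro _ ⟨i, rfl⟩
      refine ⟨DFinsupp.single i.1 ⟨1, fun h => absurd i.2.1 h⟩, ?_⟩
      simp only [DFinsupp.mapRange.linearMap_apply, DFinsupp.mapRange_single, b, bvec]
      congr 1
      apply Subtype.ext
      exact if_pos i.2
  have : Module.finrank k (LinearMap.range (DFinsupp.mapRange.linearMap
      fun i => indMap k (R i) u v)) = {i | u ∈ R i ∧ v ∈ R i}.ncard := by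
    rw [hr, finrank_span_eq_card hb, ← Nat.card_eq_fintype_card]
    rfl
  exact this

theorem rect_eq {I J : Set ℤ} (hI : I.OrdConnected) (hJ : J.OrdConnected) (s t : ℤ × ℤ)
    (hs1 : s.1 ∈ I) (hs2 : s.2 ∈ J) (ht1 : t.1 ∈ I) (ht2 : t.2 ∈ J) :
    I ×ˢ J = Set.Icc s t ↔ (s.1 - 1 ∉ I ∧ s.2 - 1 ∉ J ∧ t.1 + 1 ∉ I ∧ t.2 + 1 ∉ J) := by
  constructor
  · intro h
    have key : ∀ a b, a ∈ I → b ∈ J → (s.1 ≤ a ∧ s.2 ≤ b) ∧ (a ≤ t.1 ∧ b ≤ t.2) := by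
      intro a b ha hb
      have : (a, b) ∈ Set.Icc s t := h ▸ (⟨ha, hb⟩ : (a, b) ∈ I ×ˢ J)
      exact this
    refine ⟨fun h' => ?_, fun h' => ?_, fun h' => ?_, fun h' => ?_⟩
    · have := key _ _ h' hs2; omega
    · have := key _ _ hs1 h'; omega
    · have := key _ _ h' hs2; omega
    · have := key _ _ hs1 h'; omega
  · rintro ⟨h1, h2, h3, h4⟩
    ext ⟨a, b⟩
    constructor
    · rintro ⟨ha, hb⟩
      refine ⟨⟨?_, ?_⟩, ⟨?_, ?_⟩⟩
      · by_contra hc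
        exact h1 (hI.out ha hs1 ⟨by simp at hc ⊢; omega, by omega⟩)
      · by_contra hc
        exact h2 (hJ.out hb hs2 ⟨by simp at hc ⊢; omega, by omega⟩)
      · by_contra hc
        exact h3 (hI.out ht1 ha ⟨by omega, by simp at hc ⊢; omega⟩)
      · by_contra hc
        exact h4 (hJ.out ht2 hb ⟨by omega, by simp at hc ⊢; omega⟩)
    · rintro ⟨⟨p1, p2⟩, ⟨q1, q2⟩⟩
      exact ⟨hI.out hs1 ht1 ⟨p1, q1⟩, hJ.out hs2 ht2 ⟨p2, q2⟩⟩

theorem ncard_eq_sum {ι : Type} (T : Finset ι) (p : ι → Prop) (hp : ∀ i, p i → i ∈ T) :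
    ({i | p i}.ncard : ℤ) = ∑ i ∈ T, if p i then (1 : ℤ) else 0 := by
  rw [Finset.sum_boole]
  have : {i | p i} = ((T.filter p : Finset ι) : Set ι) := by
    ext i; simpa using hp i
  rw [this, Set.ncard_coe_finset]

end Helpers

/-- Inclusion-exclusion formula for the multiplicity `m(s,t)` of the
rectangle `[s_x,t_x] × [s_y,t_y]` in a rectangle decomposition, in terms of the rank
invariant. -/
theorem multiplicity_eq_inclusion_exclusion (k : Type) [Field k]
    (M : PersistenceModule k (ℤ × ℤ)) (hpfd : Pfd k M)
    (ι : Type) (R : ι → Set (ℤ × ℤ)) (hR : ∀ i, IsRectangle (R i))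
    (iso : M ≅ ∐ fun i => indicator k (R i) (hR i).ordConnected)
    (s t : ℤ × ℤ) (h : s ≤ t) :
    ({i | R i = Set.Icc s t}.ncard : ℤ) =
      ∑ a ∈ Finset.range 2, ∑ b ∈ Finset.range 2, ∑ c ∈ Finset.range 2,
        ∑ d ∈ Finset.range 2,
          (-1 : ℤ) ^ (a + b + c + d) *
            rk k M (s.1 - (a : ℤ), s.2 - (b : ℤ)) (t.1 + (c : ℤ), t.2 + (d : ℤ)) := by
  have hRo : ∀ i, (R i).OrdConnected := fun i => (hR i).ordConnected
  let e : M ≅ dsum k R hRo := iso ≪≫ coprodIso k R hRo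
  have hfin : ∀ v, {i | v ∈ R i}.Finite := by
    intro v
    exact finite_of_iso k R hRo M hpfd e v
  have hrk : ∀ u v, u ≤ v → rk k M u v = {i | u ∈ R i ∧ v ∈ R i}.ncard := by
    intro u v huv
    rw [rk_iso k e, rk_dsum k R hRo u v huv (hfin v)]
  let T : Finset ι := ((hfin s).inter_of_left {i | t ∈ R i}).toFinset
  have hT : ∀ i, i ∈ T ↔ s ∈ R i ∧ t ∈ R i := by
    intro i; simp [T]
  have hsum : ∀ a b c d : ℕ,
      (rk k M (s.1 - (a : ℤ), s.2 - (b : ℤ)) (t.1 + (c : ℤ), t.2 + (d : ℤ)) : ℤ) =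
      ∑ i ∈ T, if (s.1 - (a : ℤ), s.2 - (b : ℤ)) ∈ R i ∧ (t.1 + (c : ℤ), t.2 + (d : ℤ)) ∈ R i
        then (1 : ℤ) else 0 := by
    intro a b c d
    have h1 := h.1
    have h2 := h.2
    have l1 : (s.1 - (a : ℤ), s.2 - (b : ℤ)) ≤ s := ⟨by simp, by simp⟩
    have l2 : t ≤ (t.1 + (c : ℤ), t.2 + (d : ℤ)) := ⟨by simp, by simp⟩
    rw [hrk _ _ (l1.trans (h.trans l2))]
    refine (ncard_eq_sum T (fun i => (s.1 - (a : ℤ), s.2 - (b : ℤ)) ∈ R i ∧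
      (t.1 + (c : ℤ), t.2 + (d : ℤ)) ∈ R i) fun i hi => (hT i).2 ?_).trans
      (Finset.sum_congr rfl fun i _ => by congr)
    exact ⟨(hRo i).out hi.1 hi.2 ⟨l1, h.trans l2⟩, (hRo i).out hi.1 hi.2 ⟨l1.trans h, l2⟩⟩
  rw [ncard_eq_sum T (fun i => R i = Set.Icc s t) (fun i hi => (hT i).2 (by
    rw [hi]; exact ⟨⟨le_rfl, h⟩, ⟨h, le_rfl⟩⟩))]
  simp only [hsum, Finset.mul_sum]
  simp only [Finset.sum_range_succ, Finset.sum_range_zero, zero_add, ← Finset.sum_add_distrib]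
  refine Finset.sum_congr rfl fun i hi => ?_
  obtain ⟨hs, ht⟩ := (hT i).1 hi
  obtain ⟨-, I, J, hI, hJ, hRi⟩ := hR i
  rw [hRi] at hs ht ⊢
  have hs1 : s.1 ∈ I := hs.1
  have hs2 : s.2 ∈ J := hs.2
  have ht1 : t.1 ∈ I := ht.1
  have ht2 : t.2 ∈ J := ht.2
  simp only [rect_eq hI hJ s t hs1 hs2 ht1 ht2, Set.mk_mem_prod, Set.mem_prod,
    Nat.cast_zero, Nat.cast_one, sub_zero, add_zero]
  by_cases q1 : s.1 - 1 ∈ I <;> by_cases q2 : s.2 - 1 ∈ J <;>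
    by_cases q3 : t.1 + 1 ∈ I <;> by_cases q4 : t.2 + 1 ∈ J <;>
    simp [q1, q2, q3, q4, hs1, hs2, ht1, ht2]


end PersistencePaper
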